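/- Let 0 < ρ < ∞ and 0 < μ ≤ ∞, and let T be a compact H-operator with constant C on an infinite-dimensional complex Banach space X with eigenvalue enumeration (λ_n(T))_{n≥1}. Then (n^{ρ − 1/μ} |λ_n(T)|)_{n≥1} ∈ ℓ_μ if and only if (n^{ρ − 1/μ} α_n(T))_{n≥1} ∈ ℓ_μ; that is, the eigenvalue approximation space A^ρ_μ coincides with the approximation-number space X^ρ_μ for compact H-operators. -/

import Mathlib

open scoped ENNReal

section Defs

variable {X Y : Type*} [NormedAddCommGroup X] [NormedSpace ℂ X]
  [NormedAddCommGroup Y] [NormedSpace ℂ Y]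

/-- `approxNumber T n` is the `(n+1)`-st approximation number `α_{n+1}(T)`, i.e. the
distance of `T` to the operators of rank `≤ n`. -/
noncomputable def approxNumber (T : X →L[ℂ] Y) (n : ℕ) : ℝ :=
  sInf {c : ℝ | ∃ A : X →L[ℂ] Y, Module.rank ℂ (LinearMap.range A.toLinearMap) ≤ (n : Cardinal) ∧
    c = ‖T - A‖}

/-- The canonical quotient map `X → X ⧸ G` as a continuous linear map. -/
noncomputable def quotMapL (G : Submodule ℂ X) : X →L[ℂ] X ⧸ G :=
  G.mkQ.mkContinuous 1 fun x => by
    simpa using Submodule.Quotient.norm_mk_le G x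

/-- `kolmogorovDiameter T n` is the `n`-th Kolmogorov diameter `δ_n(T)` of an operator
`T : X → X`: the infimum of `‖Q_G ∘ T‖` over subspaces `G ⊆ X` with `dim G ≤ n`. -/
noncomputable def kolmogorovDiameter (T : X →L[ℂ] X) (n : ℕ) : ℝ :=
  sInf {c : ℝ | ∃ G : Submodule ℂ X, Module.rank ℂ G ≤ (n : Cardinal) ∧
    c = ‖(quotMapL G).comp T‖}

/-- `T` is an H-operator with constant `C`: its spectrum is real and
`‖(T - λI)⁻¹‖ ≤ C * |Im λ|⁻¹` whenever `Im λ ≠ 0`. -/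
def IsHOperator (T : X →L[ℂ] X) (C : ℝ) : Prop :=
  (∀ z ∈ spectrum ℂ T, z.im = 0) ∧
  ∀ lam : ℂ, lam.im ≠ 0 →
    ∃ S : X →L[ℂ] X, S.comp (T - lam • (1 : X →L[ℂ] X)) = 1 ∧
      (T - lam • (1 : X →L[ℂ] X)).comp S = 1 ∧ ‖S‖ ≤ C * |lam.im|⁻¹

/-- The algebraic multiplicity of `μ` for `T`: the dimension of
`⋃_k ker (T - μI)^k`. -/
noncomputable def algebraicMultiplicity (T : X →L[ℂ] X) (μ : ℂ) : ℕ :=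
  Module.finrank ℂ
    (⨆ k : ℕ, LinearMap.ker ((T - μ • (1 : X →L[ℂ] X)) ^ k).toLinearMap : Submodule ℂ X)

/-- `lam` enumerates the eigenvalues of the compact operator `T` in order of
nonincreasing modulus, counted with algebraic multiplicity: `|lam 0| ≥ |lam 1| ≥ ⋯`,
each term is zero or a spectral value, every nonzero `μ` occurs exactly
`d(μ) = dim ⋃_k ker (T - μI)^k` times (in particular `lam n = 0` for the remaining
indices if there are only finitely many nonzero eigenvalues), and every nonzero
point of the spectrum occurs.  Here `lam n` stands for `λ_{n+1}(T)`. -/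
def IsEigenvalueEnumeration (T : X →L[ℂ] X) (lam : ℕ → ℂ) : Prop :=
  (∀ n : ℕ, ‖lam (n + 1)‖ ≤ ‖lam n‖) ∧
  (∀ n : ℕ, lam n = 0 ∨ lam n ∈ spectrum ℂ T) ∧
  (∀ μ : ℂ, μ ≠ 0 →
    {n : ℕ | lam n = μ}.Finite ∧ {n : ℕ | lam n = μ}.ncard = algebraicMultiplicity T μ) ∧
  (∀ μ ∈ spectrum ℂ T, μ ≠ 0 → ∃ n : ℕ, lam n = μ)

end Defs

/-- Membership of a real sequence in `ℓ_μ` for `0 < μ ≤ ∞`: summability of `|c n| ^ μ`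
for finite `μ`, boundedness for `μ = ∞`. -/
def MemEllMu (μ : ℝ≥0∞) (c : ℕ → ℝ) : Prop :=
  if μ = ∞ then ∃ M : ℝ, ∀ n : ℕ, |c n| ≤ M
  else Summable fun n : ℕ => |c n| ^ μ.toReal

section BanachAlgebra

variable {A : Type*} [NormedRing A] [NormedAlgebra ℂ A]

/-- The contour integral `(2πi)⁻¹ ∮ (z⁻² - r² z⁻⁴) (1 - z a)⁻¹ dz` over `|z| = r`. It equals
`a - r² a³` when the spectrum of `a` lies in the disc `|λ| < r⁻¹`, and the weight vanishes at the
real points `±r` of the contour. -/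
noncomputable def weightedContour (a : A) (r : ℝ) : A :=
  (2 * Real.pi * Complex.I : ℂ)⁻¹ • ∮ z in C(0, r),
    ((z⁻¹) ^ 2 - (r : ℂ) ^ 2 * (z⁻¹) ^ 4) • Ring.inverse (1 - z • a)

/-- The combination of two weighted contour integrals that reproduces `a` itself when the spectrum
of `a` lies in the disc `|λ| < r⁻¹`. -/
noncomputable def innerPart (a : A) (r : ℝ) : A :=
  (4 / 3 : ℂ) • weightedContour a (r / 2) - (1 / 3 : ℂ) • weightedContour a r

theorem norm_weight_eq {r : ℝ} (hr : 0 < r) {z : ℂ} (hz : ‖z‖ = r) :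
    ‖(z⁻¹) ^ 2 - (r : ℂ) ^ 2 * (z⁻¹) ^ 4‖ = 2 * |z.im| * (r⁻¹) ^ 3 := by
  have hz0 : z ≠ 0 := by
    rw [← norm_pos_iff, hz]; exact hr
  have hr2 : (r : ℂ) ^ 2 = z * (starRingEnd ℂ) z := by
    rw [Complex.mul_conj, Complex.normSq_eq_norm_sq, hz]; push_cast; rfl
  have hsub : z - (starRingEnd ℂ) z = 2 * z.im * Complex.I := by
    rw [Complex.sub_conj]; push_cast; ring
  have : (z⁻¹) ^ 2 - (r : ℂ) ^ 2 * (z⁻¹) ^ 4 = (2 * z.im * Complex.I) * (z⁻¹) ^ 3 := by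
    rw [← hsub, hr2]; field_simp
  rw [this]
  simp [hz]

theorem norm_weightedContour_le {a : A} {C : ℝ} {r : ℝ} (hr : 0 < r)
    (ha : ∀ z : ℂ, z.im ≠ 0 → ‖Ring.inverse (1 - z • a)‖ * |z.im| ≤ C * ‖z‖) (hC : 0 ≤ C) :
    ‖weightedContour a r‖ ≤ 2 * C * r⁻¹ := by
  have h := circleIntegral.norm_two_pi_i_inv_smul_integral_le_of_norm_le_const (c := 0)
    (f := fun z => ((z⁻¹) ^ 2 - (r : ℂ) ^ 2 * (z⁻¹) ^ 4) • Ring.inverse (1 - z • a))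
    (C := 2 * C * (r⁻¹) ^ 2) hr.le ?_
  · refine h.trans (le_of_eq ?_)
    field_simp
  · intro z hz
    have hz : ‖z‖ = r := by simpa using hz
    rw [norm_smul, norm_weight_eq hr hz]
    rcases eq_or_ne z.im 0 with h0 | h0
    · rw [h0]; simp; positivity
    · have := ha z h0
      rw [hz] at this
      calc 2 * |z.im| * (r⁻¹) ^ 3 * ‖Ring.inverse (1 - z • a)‖
          = 2 * (r⁻¹) ^ 3 * (‖Ring.inverse (1 - z • a)‖ * |z.im|) := by ring
        _ ≤ 2 * (r⁻¹) ^ 3 * (C * r) := by gcongr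
        _ = 2 * C * (r⁻¹) ^ 2 := by field_simp

theorem norm_innerPart_le {a : A} {C : ℝ} {r : ℝ} (hr : 0 < r)
    (ha : ∀ z : ℂ, z.im ≠ 0 → ‖Ring.inverse (1 - z • a)‖ * |z.im| ≤ C * ‖z‖) (hC : 0 ≤ C) :
    ‖innerPart a r‖ ≤ 6 * C * r⁻¹ := by
  have h1 := norm_weightedContour_le hr ha hC
  have h2 := norm_weightedContour_le (half_pos hr) ha hC
  calc ‖innerPart a r‖
      ≤ ‖(4 / 3 : ℂ) • weightedContour a (r / 2)‖ + ‖(1 / 3 : ℂ) • weightedContour a r‖ :=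
        norm_sub_le _ _
    _ = 4 / 3 * ‖weightedContour a (r / 2)‖ + 1 / 3 * ‖weightedContour a r‖ := by
        simp [norm_smul]
    _ ≤ 4 / 3 * (2 * C * (r / 2)⁻¹) + 1 / 3 * (2 * C * r⁻¹) := by gcongr
    _ = 6 * C * r⁻¹ := by field_simp; ring

variable [CompleteSpace A]

theorem differentiableAt_inverse_one_sub_smul {a : A} {z : ℂ} (h : IsUnit (1 - z • a)) :
    DifferentiableAt ℂ (fun z : ℂ => Ring.inverse (1 - z • a)) z := by
  have H₁ : Differentiable ℂ fun w : ℂ => 1 - w • a := (differentiable_id.smul_const a).const_sub 1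
  exact DifferentiableAt.comp z (differentiableAt_inverse h) H₁.differentiableAt

theorem continuousOn_weight_smul_inverse {a : A} {r : ℝ} (hr : 0 < r)
    (h : ∀ z : ℂ, ‖z‖ = r → IsUnit (1 - z • a)) (c : ℂ) (m : ℕ) :
    ContinuousOn (fun z : ℂ => (c * (z⁻¹) ^ m) • Ring.inverse (1 - z • a))
      (Metric.sphere 0 r) := by
  intro z hz
  have hz : ‖z‖ = r := by simpa using hz
  have hz0 : z ≠ 0 := by
    rw [← norm_pos_iff, hz]; exact hr
  refine ContinuousAt.continuousWithinAt ?_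
  have h1 := (differentiableAt_inverse_one_sub_smul (h z hz)).continuousAt
  exact (continuousAt_const.mul ((continuousAt_inv₀ hz0).pow m)).smul h1

theorem circleIntegrable_weight_smul_inverse {a : A} {r : ℝ} (hr : 0 < r)
    (h : ∀ z : ℂ, ‖z‖ = r → IsUnit (1 - z • a)) :
    CircleIntegrable
      (fun z : ℂ => ((z⁻¹) ^ 2 - (r : ℂ) ^ 2 * (z⁻¹) ^ 4) • Ring.inverse (1 - z • a)) 0 r := by
  refine ContinuousOn.circleIntegrable hr.le ?_
  have h1 := continuousOn_weight_smul_inverse hr h 1 2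
  have h2 := continuousOn_weight_smul_inverse hr h ((r : ℂ) ^ 2) 4
  refine (h1.sub h2).congr fun z _ => ?_
  simp [sub_smul]

theorem two_pi_I_inv_smul_circleIntegral_inverse {a : A} {r : ℝ} (hr : 0 < r)
    (h : ∀ z : ℂ, ‖z‖ ≤ r → IsUnit (1 - z • a)) (n : ℕ) :
    (2 * Real.pi * Complex.I : ℂ)⁻¹ • ∮ z in C(0, r),
      (z⁻¹) ^ (n + 1) • Ring.inverse (1 - z • a) = a ^ n := by
  lift r to NNReal using hr.le
  have hd : DifferentiableOn ℂ (fun z : ℂ => Ring.inverse (1 - z • a)) (Metric.closedBall 0 r) :=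
    fun z hz => (differentiableAt_inverse_one_sub_smul
      (h z (by simpa using hz))).differentiableWithinAt
  have H₁ := hd.hasFPowerSeriesOnBall (by exact_mod_cast hr)
  have H₂ := spectrum.hasFPowerSeriesOnBall_inverse_one_sub_smul ℂ a
  have := H₁.hasFPowerSeriesAt.eq_formalMultilinearSeries H₂.hasFPowerSeriesAt
  have h3 := congrArg (fun p => p n fun _ => (1 : ℂ)) this
  simp only [cauchyPowerSeries_apply] at h3
  simpa [pow_succ, mul_smul] using h3

theorem weightedContour_eq {a : A} {r : ℝ} (hr : 0 < r)
    (h : ∀ z : ℂ, ‖z‖ ≤ r → IsUnit (1 - z • a)) :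
    weightedContour a r = a - (r : ℂ) ^ 2 • a ^ 3 := by
  have h' : ∀ z : ℂ, ‖z‖ = r → IsUnit (1 - z • a) := fun z hz => h z hz.le
  have h1 := (continuousOn_weight_smul_inverse hr h' 1 2).circleIntegrable hr.le
  have h2 := (continuousOn_weight_smul_inverse hr h' ((r : ℂ) ^ 2) 4).circleIntegrable hr.le
  have e1 := two_pi_I_inv_smul_circleIntegral_inverse hr h 1
  have e3 := two_pi_I_inv_smul_circleIntegral_inverse hr h 3
  have hs := circleIntegral.integral_sub h1 h2
  simp only [one_mul, mul_smul] at hs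
  rw [circleIntegral.integral_smul] at hs
  rw [weightedContour]
  simp only [sub_smul, mul_smul]
  rw [hs, smul_sub, smul_comm _ ((r : ℂ) ^ 2)]
  simp only [Nat.reduceAdd, pow_one] at e1 e3
  rw [e1, e3]

theorem innerPart_eq {a : A} {r : ℝ} (hr : 0 < r)
    (h : ∀ z : ℂ, ‖z‖ ≤ r → IsUnit (1 - z • a)) : innerPart a r = a := by
  rw [innerPart, weightedContour_eq hr h,
    weightedContour_eq (half_pos hr) fun z hz => h z (by linarith)]
  push_cast
  module

/-- An element with `‖(1 - z a)⁻¹‖ ≤ C |z| / |Im z|` has norm at most `6 C` times any strict upper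
bound of the moduli of its spectral values. -/
theorem norm_le_of_resolvent_bound {a : A} {C : ℝ} {r : ℝ} (hr : 0 < r)
    (ha : ∀ z : ℂ, z.im ≠ 0 → ‖Ring.inverse (1 - z • a)‖ * |z.im| ≤ C * ‖z‖) (hC : 0 ≤ C)
    (h : ∀ z : ℂ, ‖z‖ ≤ r → IsUnit (1 - z • a)) : ‖a‖ ≤ 6 * C * r⁻¹ := by
  simpa [innerPart_eq hr h] using norm_innerPart_le hr ha hC

end BanachAlgebra
section EigenspaceSum

variable {K V : Type*} [Field K] [AddCommGroup V] [Module K V]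

/-- The sum of the eigenspaces of `f` over the finite set `s`. -/
def eigenspaceSum (f : Module.End K V) (s : Finset K) : Submodule K V :=
  ⨆ μ ∈ s, f.eigenspace μ

theorem eigenspaceSum_le_iff {f : Module.End K V} {s : Finset K} {p : Submodule K V} :
    eigenspaceSum f s ≤ p ↔ ∀ μ ∈ s, f.eigenspace μ ≤ p := by
  simp [eigenspaceSum]

theorem eigenspace_le_eigenspaceSum {f : Module.End K V} {s : Finset K} {μ : K} (h : μ ∈ s) :
    f.eigenspace μ ≤ eigenspaceSum f s :=
  le_iSup₂_of_le μ h le_rfl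

theorem map_mem_eigenspaceSum {f : Module.End K V} {s : Finset K} {x : V}
    (hx : x ∈ eigenspaceSum f s) : f x ∈ eigenspaceSum f s := by
  suffices eigenspaceSum f s ≤ (eigenspaceSum f s).comap f from this hx
  refine eigenspaceSum_le_iff.2 fun μ hμ y hy => ?_
  rw [Submodule.mem_comap, Module.End.mem_eigenspace_iff.1 hy]
  exact Submodule.smul_mem _ _ (eigenspace_le_eigenspaceSum hμ hy)

theorem exists_map_sub_smul_eq {f : Module.End K V} {s : Finset K} {z : K} (hz : z ∉ s) {x : V}
    (hx : x ∈ eigenspaceSum f s) : ∃ y ∈ eigenspaceSum f s, f y - z • y = x := by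
  suffices eigenspaceSum f s ≤ (eigenspaceSum f s).map (f - z • 1) by
    obtain ⟨y, hy, h⟩ := this hx
    exact ⟨y, hy, by simpa using h⟩
  refine eigenspaceSum_le_iff.2 fun μ hμ y hy => ?_
  have hne : μ - z ≠ 0 := sub_ne_zero.2 fun h => hz (h ▸ hμ)
  refine ⟨(μ - z)⁻¹ • y, Submodule.smul_mem _ _ (eigenspace_le_eigenspaceSum hμ hy), ?_⟩
  have := Module.End.mem_eigenspace_iff.1 hy
  simp only [map_smul, LinearMap.sub_apply, this, LinearMap.smul_apply, Module.End.one_apply,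
    ← sub_smul]
  rw [smul_smul, inv_mul_cancel₀ hne, one_smul]

theorem eigenspaceSum_insert [DecidableEq K] (f : Module.End K V) (s : Finset K) (μ : K) :
    eigenspaceSum f (insert μ s) = f.eigenspace μ ⊔ eigenspaceSum f s := by
  simp [eigenspaceSum, Finset.mem_insert, iSup_or, iSup_sup_eq]

theorem finiteDimensional_eigenspaceSum {f : Module.End K V} {s : Finset K}
    (h : ∀ μ ∈ s, FiniteDimensional K (f.eigenspace μ)) :
    FiniteDimensional K (eigenspaceSum f s) := by
  classical
  induction s using Finset.induction_on with
  | empty =>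
    rw [show eigenspaceSum f ∅ = ⊥ by simp [eigenspaceSum]]
    infer_instance
  | insert μ s hμ ih =>
    have := h μ (by simp)
    have := ih fun ν hν => h ν (by simp [hν])
    rw [eigenspaceSum_insert]
    infer_instance

theorem finrank_eigenspaceSum {f : Module.End K V} {s : Finset K}
    (h : ∀ μ ∈ s, FiniteDimensional K (f.eigenspace μ)) :
    Module.finrank K (eigenspaceSum f s) = ∑ μ ∈ s, Module.finrank K (f.eigenspace μ) := by
  classical
  induction s using Finset.induction_on with
  | empty =>
    rw [show eigenspaceSum f ∅ = ⊥ by simp [eigenspaceSum]]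
    simp
  | insert μ s hμ ih =>
    have := h μ (by simp)
    have hs := fun ν hν => h ν (Finset.mem_insert_of_mem hν)
    have := finiteDimensional_eigenspaceSum hs
    have hd : Disjoint (f.eigenspace μ) (eigenspaceSum f s) := by
      refine (f.eigenspaces_iSupIndep μ).mono_right (eigenspaceSum_le_iff.2 fun ν hν => ?_)
      exact le_iSup₂_of_le ν (fun h => hμ (h ▸ hν)) le_rfl
    have := Submodule.finrank_sup_add_finrank_inf_eq (f.eigenspace μ) (eigenspaceSum f s)
    rw [hd.eq_bot, finrank_bot] at this
    rw [eigenspaceSum_insert, Finset.sum_insert hμ, ← ih hs]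
    simpa using this

/-- If `f` has no generalized eigenvectors of rank two for `z` and the eigenspace of `z` is
contained in `eigenspaceSum f s`, then `f - z` is injective modulo `eigenspaceSum f s`. -/
theorem mem_eigenspaceSum_of_map_sub_smul_mem {f : Module.End K V} {s : Finset K} {z : K} {x : V}
    (hasc : ∀ y, f y - z • y ∈ f.eigenspace z → y ∈ f.eigenspace z)
    (hz : f.eigenspace z ≤ eigenspaceSum f s) (hx : f x - z • x ∈ eigenspaceSum f s) :
    x ∈ eigenspaceSum f s := by
  classical
  have hle : eigenspaceSum f s ≤ f.eigenspace z ⊔ eigenspaceSum f (s.erase z) := by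
    rw [← eigenspaceSum_insert]
    exact eigenspaceSum_le_iff.2 fun μ hμ => eigenspace_le_eigenspaceSum <| by
      rcases eq_or_ne μ z with h | h <;> simp [h, hμ]
  have hge : eigenspaceSum f (s.erase z) ≤ eigenspaceSum f s :=
    eigenspaceSum_le_iff.2 fun μ hμ =>
      eigenspace_le_eigenspaceSum (Finset.mem_of_mem_erase hμ)
  obtain ⟨y, hy, w, hw, hyw⟩ := Submodule.mem_sup.1 (hle hx)
  obtain ⟨v, hv, rfl⟩ := exists_map_sub_smul_eq (Finset.notMem_erase z s) hw
  have : x - v ∈ f.eigenspace z := by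
    refine hasc _ ?_
    have e : f (x - v) - z • (x - v) = y := by
      rw [map_sub, smul_sub, sub_sub_sub_comm, ← hyw, add_sub_cancel_right]
    rwa [e]
  simpa using Submodule.add_mem _ (hz this) (hge hv)

end EigenspaceSum

section HOperator

variable {X : Type*} [NormedAddCommGroup X] [NormedSpace ℂ X] {T : X →L[ℂ] X} {C : ℝ}

theorem IsHOperator.isUnit_one_sub_smul_and_norm_inverse_le (hH : IsHOperator T C) {z : ℂ}
    (hz : z.im ≠ 0) :
    IsUnit (1 - z • T) ∧ ‖Ring.inverse (1 - z • T)‖ * |z.im| ≤ C * ‖z‖ := by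
  have hz0 : z ≠ 0 := fun h => hz (by simp [h])
  have him : (z⁻¹).im ≠ 0 := by
    rw [Complex.inv_im]
    exact div_ne_zero (neg_ne_zero.2 hz) (by simpa using hz0)
  obtain ⟨S, h1, h2, hS⟩ := hH.2 z⁻¹ him
  have e : (1 : X →L[ℂ] X) - z • T = (-z) • (T - z⁻¹ • (1 : X →L[ℂ] X)) := by
    rw [smul_sub, smul_smul, neg_mul, mul_inv_cancel₀ hz0]
    module
  have h1' : ((-z)⁻¹ • S) * (1 - z • T) = 1 := by
    rw [e, smul_mul_smul_comm, inv_mul_cancel₀ (neg_ne_zero.2 hz0), one_smul]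
    exact h1
  have h2' : (1 - z • T) * ((-z)⁻¹ • S) = 1 := by
    rw [e, smul_mul_smul_comm, mul_inv_cancel₀ (neg_ne_zero.2 hz0), one_smul]
    exact h2
  let u : (X →L[ℂ] X)ˣ := ⟨1 - z • T, (-z)⁻¹ • S, h2', h1'⟩
  have hu : Ring.inverse (1 - z • T) = (-z)⁻¹ • S := Ring.inverse_unit u
  refine ⟨u.isUnit, ?_⟩
  have hzp : 0 < ‖z‖ := norm_pos_iff.2 hz0
  have hip : 0 < |z.im| := abs_pos.2 hz
  have habs : |(z⁻¹).im|⁻¹ = ‖z‖ ^ 2 * |z.im|⁻¹ := by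
    rw [Complex.inv_im, abs_div, abs_neg, Complex.normSq_eq_norm_sq, abs_of_nonneg (sq_nonneg ‖z‖),
      inv_div, div_eq_mul_inv]
  rw [hu, norm_smul, norm_inv, norm_neg]
  rw [habs] at hS
  calc ‖z‖⁻¹ * ‖S‖ * |z.im| ≤ ‖z‖⁻¹ * (C * (‖z‖ ^ 2 * |z.im|⁻¹)) * |z.im| := by gcongr
    _ = C * ‖z‖ := by field_simp

theorem IsHOperator.abs_im_mul_norm_le (hH : IsHOperator T C) {z : ℂ} (hz : z.im ≠ 0) (x : X) :
    |z.im| * ‖x‖ ≤ C * ‖T x - z • x‖ := by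
  obtain ⟨S, h1, -, hS⟩ := hH.2 z hz
  have hx : S (T x - z • x) = x := by
    simpa using congrArg (fun B : X →L[ℂ] X => B x) h1
  have hip : 0 < |z.im| := abs_pos.2 hz
  calc |z.im| * ‖x‖ = |z.im| * ‖S (T x - z • x)‖ := by rw [hx]
    _ ≤ |z.im| * (C * |z.im|⁻¹ * ‖T x - z • x‖) := by
        gcongr; exact S.le_of_opNorm_le hS _
    _ = C * ‖T x - z • x‖ := by field_simp

theorem IsHOperator.mem_eigenspace_of_map_sub_smul_mem (hH : IsHOperator T C) {μ : ℂ} {x : X}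
    (hx : T x - μ • x ∈ Module.End.eigenspace T.toLinearMap μ) :
    x ∈ Module.End.eigenspace T.toLinearMap μ := by
  rw [Module.End.mem_eigenspace_iff] at hx ⊢
  set y := T x - μ • x with hy
  have hTy : T y = μ • y := hx
  suffices y = 0 from sub_eq_zero.1 this
  by_cases him : μ.im = 0
  · have key : ∀ ε : ℝ, 0 < ε → ‖y‖ ≤ (1 + C) * ‖x‖ * ε := by
      intro ε hε
      have hε' : (ε : ℂ) ≠ 0 := by exact_mod_cast hε.ne'
      -- The operator `T - μ - iε` sends `y + iε x` to `ε² x`.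
      have hz : (μ + ε * Complex.I).im ≠ 0 := by simp [him, hε.ne']
      have h := hH.abs_im_mul_norm_le hz (y + (ε * Complex.I) • x)
      have e : T (y + (ε * Complex.I) • x) - (μ + ε * Complex.I) • (y + (ε * Complex.I) • x)
          = (ε ^ 2 : ℂ) • x := by
        have hTx : T x = y + μ • x := by rw [hy]; abel
        rw [map_add, map_smul, hTy, hTx]
        have hI : (ε * Complex.I) * (ε * Complex.I) = -(ε ^ 2 : ℂ) := by
          linear_combination (ε : ℂ) ^ 2 * Complex.I_mul_I
        rw [← neg_eq_iff_eq_neg.2 hI]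
        module
      rw [e, norm_smul] at h
      have him' : |(μ + ε * Complex.I).im| = ε := by simp [him, abs_of_pos hε]
      rw [him'] at h
      have hn : ‖(ε ^ 2 : ℂ)‖ = ε ^ 2 := by simp [abs_of_pos hε]
      rw [hn] at h
      have h' : ‖y + (ε * Complex.I) • x‖ ≤ C * (ε * ‖x‖) := by
        refine le_of_mul_le_mul_left ?_ hε
        linarith
      have h3 : ‖y‖ ≤ ‖y + (ε * Complex.I) • x‖ + ‖(ε * Complex.I) • x‖ := by
        simpa using norm_sub_le (y + (ε * Complex.I) • x) ((ε * Complex.I) • x)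
      have h4 : ‖(ε * Complex.I) • x‖ = ε * ‖x‖ := by simp [norm_smul, abs_of_pos hε]
      rw [h4] at h3
      linarith
    have : ‖y‖ ≤ 0 := by
      refine ge_of_tendsto (x := nhdsWithin (0 : ℝ) (Set.Ioi 0))
        (f := fun ε : ℝ => (1 + C) * ‖x‖ * ε) ?_ ?_
      · have : Continuous fun ε : ℝ => (1 + C) * ‖x‖ * ε := by fun_prop
        simpa using (this.tendsto 0).mono_left nhdsWithin_le_nhds
      · filter_upwards [self_mem_nhdsWithin] with ε hε using key ε hε
    simpa using this
  · have h := hH.abs_im_mul_norm_le him y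
    rw [hTy, sub_self, norm_zero, mul_zero] at h
    have hip : 0 < |μ.im| := abs_pos.2 him
    have : ‖y‖ ≤ 0 := by nlinarith [norm_nonneg y]
    simpa using this

theorem IsHOperator.algebraicMultiplicity_eq (hH : IsHOperator T C) (μ : ℂ) :
    algebraicMultiplicity T μ = Module.finrank ℂ (Module.End.eigenspace T.toLinearMap μ) := by
  have hker : ∀ (k : ℕ) (x : X), ((T - μ • (1 : X →L[ℂ] X)) ^ k) x = 0 →
      x ∈ Module.End.eigenspace T.toLinearMap μ := by
    intro k
    induction k with
    | zero =>
      intro x hx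
      have : x = 0 := by simpa using hx
      rw [this]; exact zero_mem _
    | succ k ih =>
      intro x hx
      refine hH.mem_eigenspace_of_map_sub_smul_mem (ih _ ?_)
      rw [pow_succ] at hx
      simpa using hx
  have : (⨆ k : ℕ, LinearMap.ker ((T - μ • (1 : X →L[ℂ] X)) ^ k).toLinearMap : Submodule ℂ X)
      = Module.End.eigenspace T.toLinearMap μ := by
    refine le_antisymm (iSup_le fun k x hx => hker k x (LinearMap.mem_ker.1 hx)) ?_
    refine le_iSup_of_le 1 fun x hx => ?_
    have := Module.End.mem_eigenspace_iff.1 hx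
    simpa [sub_eq_zero] using this
  rw [algebraicMultiplicity, this]

theorem IsCompactOperator.finiteDimensional_eigenspace [CompleteSpace X]
    (hT : IsCompactOperator T) {μ : ℂ}
    (hμ : μ ≠ 0) : FiniteDimensional ℂ (Module.End.eigenspace T.toLinearMap μ) := by
  have hT' : IsCompactOperator T.toLinearMap := hT
  replace hT' := hT'.restrict' ((Module.End.mem_invtSubmodule_iff_forall_mem_of_mem _).mp
    (Module.End.eigenspace_mem_invtSubmodule T.toLinearMap μ))
  rw [Module.End.restrict_eigenspace, LinearMap.coe_smul, IsCompactOperator.smul_iff₀ hμ] at hT'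
  rwa [← isCompactOperator_id_iff_finiteDimensional]

theorem isUnit_one_sub_smul_of_inv_notMem_spectrum {A : Type*} [Ring A] [Algebra ℂ A] {a : A}
    {z : ℂ} (h : z ≠ 0 → z⁻¹ ∉ spectrum ℂ a) : IsUnit (1 - z • a) := by
  rcases eq_or_ne z 0 with rfl | hz
  · simp
  · have h1 : IsUnit (algebraMap ℂ A z⁻¹ - a) := spectrum.notMem_iff.1 (h hz)
    have : 1 - z • a = Units.mk0 z hz • (algebraMap ℂ A z⁻¹ - a) := by
      rw [Units.smul_def, Units.val_mk0, smul_sub, Algebra.algebraMap_eq_smul_one, smul_smul,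
        mul_inv_cancel₀ hz, one_smul]
    rw [this]
    exact h1.smul _

theorem ContinuousLinearMap.map_circleIntegral {Z Y : Type*} [NormedAddCommGroup Z]
    [NormedSpace ℂ Z] [CompleteSpace Z] [NormedAddCommGroup Y] [NormedSpace ℂ Y] [CompleteSpace Y]
    (L : Z →L[ℂ] Y) {f : ℂ → Z} {c : ℂ} {r : ℝ} (hf : CircleIntegrable f c r) :
    L (∮ z in C(c, r), f z) = ∮ z in C(c, r), L (f z) := by
  rw [circleIntegral, circleIntegral, ← L.intervalIntegral_comp_comm hf.out]
  simp

/-- The operator induced by `T` on the quotient by an invariant subspace. -/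
def quotientOperator (T : X →L[ℂ] X) (E : Submodule ℂ X) (hE : ∀ x ∈ E, T x ∈ E) :
    X ⧸ E →L[ℂ] X ⧸ E :=
  E.liftQL (E.mkQL.comp T) fun x hx => by simpa using hE x hx

theorem IsCompactOperator.quotientOperator (hT : IsCompactOperator T) (E : Submodule ℂ X)
    (hE : ∀ x ∈ E, T x ∈ E) : IsCompactOperator (quotientOperator T E hE) := by
  obtain ⟨K, hK, hK'⟩ := hT.clm_comp E.mkQL
  refine ⟨K, hK, ?_⟩
  have := E.isOpenQuotientMap_mkQL.isOpenMap.image_mem_nhds hK'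
  rw [map_zero] at this
  refine Filter.mem_of_superset this ?_
  rintro _ ⟨x, hx, rfl⟩
  exact hx

section Quotient

variable {Y : Type*} [NormedAddCommGroup Y] [NormedSpace ℂ Y] [CompleteSpace X] [CompleteSpace Y]

theorem apply_weightedContour_of_intertwine {B : Y →L[ℂ] Y} {Q : X →L[ℂ] Y}
    (hQ : ∀ x, Q (T x) = B (Q x)) {r : ℝ} (hr : 0 < r)
    (h : ∀ z : ℂ, ‖z‖ = r → IsUnit (1 - z • T)) (hB : ∀ z : ℂ, ‖z‖ = r → IsUnit (1 - z • B))
    (x : X) : Q (weightedContour T r x) = weightedContour B r (Q x) := by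
  have hinv : ∀ z : ℂ, ‖z‖ = r →
      Q (Ring.inverse (1 - z • T) x) = Ring.inverse (1 - z • B) (Q x) := by
    intro z hz
    have h1 : (1 - z • T) (Ring.inverse (1 - z • T) x) = x :=
      congrArg (fun S : X →L[ℂ] X => S x) (Ring.mul_inverse_cancel _ (h z hz))
    have h2 : ∀ y, Ring.inverse (1 - z • B) ((1 - z • B) y) = y := fun y =>
      congrArg (fun S : Y →L[ℂ] Y => S y) (Ring.inverse_mul_cancel _ (hB z hz))
    have h3 : ∀ y, Q ((1 - z • T) y) = (1 - z • B) (Q y) := fun y => by simp [hQ]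
    rw [← h2 (Q (Ring.inverse (1 - z • T) x)), ← h3, h1]
  have e1 := (Q.comp (ContinuousLinearMap.apply ℂ X x)).map_circleIntegral
    (circleIntegrable_weight_smul_inverse hr h)
  have e2 := (ContinuousLinearMap.apply ℂ Y (Q x)).map_circleIntegral
    (circleIntegrable_weight_smul_inverse hr hB)
  simp only [ContinuousLinearMap.comp_apply, ContinuousLinearMap.apply_apply] at e1 e2
  simp only [weightedContour, smul_apply, map_smul, e1, e2]
  congr 1
  refine circleIntegral.integral_congr hr.le fun z hz => ?_
  simp [hinv z (by simpa using hz)]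

theorem apply_innerPart_of_intertwine {B : Y →L[ℂ] Y} {Q : X →L[ℂ] Y}
    (hQ : ∀ x, Q (T x) = B (Q x)) {r : ℝ} (hr : 0 < r)
    (h : ∀ z : ℂ, ‖z‖ = r ∨ ‖z‖ = r / 2 → IsUnit (1 - z • T))
    (hB : ∀ z : ℂ, ‖z‖ ≤ r → IsUnit (1 - z • B)) (x : X) :
    Q (innerPart T r x) = B (Q x) := by
  have h1 := apply_weightedContour_of_intertwine hQ hr (fun z hz => h z (.inl hz))
    (fun z hz => hB z hz.le) x
  have h2 := apply_weightedContour_of_intertwine hQ (half_pos hr) (fun z hz => h z (.inr hz))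
    (fun z hz => hB z (by linarith)) x
  conv_rhs => rw [← innerPart_eq hr hB]
  simp [innerPart, h1, h2]

theorem isUnit_one_sub_smul_quotientOperator (hH : IsHOperator T C) (hT : IsCompactOperator T)
    {s : Finset ℂ} [IsClosed (eigenspaceSum T.toLinearMap s : Set X)] {z : ℂ}
    (hz : z ≠ 0 → z⁻¹ ∈ spectrum ℂ T → z⁻¹ ∈ s) :
    IsUnit (1 - z • quotientOperator T (eigenspaceSum T.toLinearMap s)
      fun _ hx => map_mem_eigenspaceSum hx) := by
  refine isUnit_one_sub_smul_of_inv_notMem_spectrum fun hz0 hspec => ?_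
  have hev := ((hT.quotientOperator (eigenspaceSum T.toLinearMap s)
    fun _ hx => map_mem_eigenspaceSum hx).hasEigenvalue_iff_mem_spectrum (inv_ne_zero hz0)).2 hspec
  obtain ⟨q, hq, hq0⟩ := hev.exists_hasEigenvector
  obtain ⟨x, rfl⟩ := Submodule.Quotient.mk_surjective _ q
  refine hq0 ((Submodule.Quotient.mk_eq_zero _).2 ?_)
  refine mem_eigenspaceSum_of_map_sub_smul_mem (z := z⁻¹)
    (fun y hy => hH.mem_eigenspace_of_map_sub_smul_mem hy) ?_ ?_
  · by_cases hs : z⁻¹ ∈ s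
    · exact eigenspace_le_eigenspaceSum hs
    · have : ¬ Module.End.HasEigenvalue T.toLinearMap z⁻¹ := fun h =>
        hs (hz hz0 ((hT.hasEigenvalue_iff_mem_spectrum (inv_ne_zero hz0)).1 h))
      rw [Module.End.hasEigenvalue_iff, not_not] at this
      rw [this]
      exact bot_le
  · rw [← Submodule.Quotient.mk_eq_zero, Submodule.Quotient.mk_sub, Submodule.Quotient.mk_smul,
      sub_eq_zero]
    exact Module.End.mem_eigenspace_iff.1 hq

end Quotient

theorem approxNumber_le_norm_sub {A : X →L[ℂ] X} {n : ℕ}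
    (hA : Module.rank ℂ (LinearMap.range A.toLinearMap) ≤ (n : Cardinal)) :
    approxNumber T n ≤ ‖T - A‖ :=
  csInf_le ⟨0, by rintro _ ⟨A, -, rfl⟩; exact norm_nonneg _⟩ ⟨A, hA, rfl⟩

theorem approxNumber_nonneg (T : X →L[ℂ] X) (n : ℕ) : 0 ≤ approxNumber T n :=
  Real.sInf_nonneg (by rintro _ ⟨A, -, rfl⟩; exact norm_nonneg _)

theorem IsHOperator.approxNumber_le_of_spectrum [CompleteSpace X] (hH : IsHOperator T C)
    (hC : 0 ≤ C) (hT : IsCompactOperator T) {s : Finset ℂ} (hs : ∀ μ ∈ s, μ ≠ 0) {r : ℝ}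
    (hr : 0 < r) (hspec : ∀ μ ∈ spectrum ℂ T, r ≤ ‖μ‖ → μ ∈ s)
    (hr1 : ∀ μ ∈ spectrum ℂ T, ‖μ‖ ≠ r) (hr2 : ∀ μ ∈ spectrum ℂ T, ‖μ‖ ≠ 2 * r) {n : ℕ}
    (hn : Module.finrank ℂ (eigenspaceSum T.toLinearMap s) ≤ n) :
    approxNumber T n ≤ 6 * C * r := by
  set E := eigenspaceSum T.toLinearMap s
  have hfin : FiniteDimensional ℂ E :=
    finiteDimensional_eigenspaceSum fun μ hμ => hT.finiteDimensional_eigenspace (hs μ hμ)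
  have hcl : IsClosed (E : Set X) := E.closed_of_finiteDimensional
  have hE : ∀ x ∈ E, T x ∈ E := fun x hx => map_mem_eigenspaceSum hx
  have hQ : ∀ x, E.mkQL (innerPart T r⁻¹ x) = E.mkQL (T x) := by
    intro x
    refine apply_innerPart_of_intertwine (T := T) (Q := E.mkQL)
      (B := quotientOperator T E hE) (fun y => rfl)
      (inv_pos.2 hr) (fun z hz => ?_) (fun z hz => ?_) x
    · refine isUnit_one_sub_smul_of_inv_notMem_spectrum fun hz0 hmem => ?_
      rcases hz with hz | hz
      · exact hr1 _ hmem (by rw [norm_inv, hz, inv_inv])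
      · exact hr2 _ hmem (by rw [norm_inv, hz, inv_div, div_inv_eq_mul])
    · refine isUnit_one_sub_smul_quotientOperator hH hT fun hz0 hmem => hspec _ hmem ?_
      rw [norm_inv, ← inv_inv r]
      exact inv_anti₀ (norm_pos_iff.2 hz0) hz
  have hrange : LinearMap.range (T - innerPart T r⁻¹).toLinearMap ≤ E := by
    rintro _ ⟨x, rfl⟩
    rw [← Submodule.Quotient.mk_eq_zero]
    have := hQ x
    simp only [Submodule.mkQL_apply, Submodule.mkQ_apply] at this
    simp [this]
  have hrank : Module.rank ℂ (LinearMap.range (T - innerPart T r⁻¹).toLinearMap) ≤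
      (n : Cardinal) := by
    refine (Submodule.rank_mono hrange).trans ?_
    rw [← Module.finrank_eq_rank]
    exact_mod_cast hn
  have h := approxNumber_le_norm_sub (T := T) hrank
  rw [sub_sub_cancel] at h
  have h2 := norm_innerPart_le (a := T) (inv_pos.2 hr)
    (fun z hz => (hH.isUnit_one_sub_smul_and_norm_inverse_le hz).2) hC
  rw [inv_inv] at h2
  exact h.trans h2

theorem mul_norm_le_of_finiteDimensional {Y : Type*} [NormedAddCommGroup Y] [NormedSpace ℂ Y]
    [FiniteDimensional ℂ Y] {B : Y →L[ℂ] Y} (hC : 0 ≤ C) {r : ℝ} (hr : 0 < r)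
    (hB : ∀ z : ℂ, ‖z‖ ≤ r → IsUnit (B - z • (1 : Y →L[ℂ] Y)))
    (him : ∀ (z : ℂ) (y : Y), z.im ≠ 0 → |z.im| * ‖y‖ ≤ C * ‖B y - z • y‖) (y : Y) :
    r * ‖y‖ ≤ 6 * (C + 1) * ‖B y‖ := by
  have : CompleteSpace Y := FiniteDimensional.complete ℂ Y
  have hunit : ∀ z : ℂ, z.im ≠ 0 → IsUnit (B - z • (1 : Y →L[ℂ] Y)) := by
    intro z hz
    have hinj : Function.Injective (B - z • (1 : Y →L[ℂ] Y)) := by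
      rw [injective_iff_map_eq_zero]
      intro y hy
      have h := him z y hz
      have h0 : B y - z • y = 0 := hy
      rw [h0, norm_zero, mul_zero] at h
      have hip : 0 < |z.im| := abs_pos.2 hz
      have : ‖y‖ ≤ 0 := by nlinarith [norm_nonneg y]
      simpa using this
    rw [ContinuousLinearMap.isUnit_iff_bijective]
    exact ⟨hinj, LinearMap.injective_iff_surjective
      (f := (B - z • (1 : Y →L[ℂ] Y)).toLinearMap).1 hinj⟩
  have hunit0 : IsUnit B := by
    have := hB 0 (by simpa using hr.le)
    rwa [zero_smul, sub_zero] at this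
  set b := Ring.inverse B
  have hTb : B * b = 1 := Ring.mul_inverse_cancel _ hunit0
  have hbT : b * B = 1 := Ring.inverse_mul_cancel _ hunit0
  have hb : ∀ z : ℂ, 1 - z • b = (B - z • (1 : Y →L[ℂ] Y)) * b := fun z => by
    rw [sub_mul, hTb, smul_mul_assoc, one_mul]
  have hbunit : IsUnit b := ⟨⟨b, B, hbT, hTb⟩, rfl⟩
  have hnorm : ‖b‖ ≤ 6 * (C + 1) * r⁻¹ := by
    refine norm_le_of_resolvent_bound (C := C + 1) hr (fun z hz => ?_) (by positivity)
      (fun z hz => ?_)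
    · have hu : IsUnit (1 - z • b) := by
        rw [hb]; exact (hunit z hz).mul hbunit
      have hip : 0 < |z.im| := abs_pos.2 hz
      rw [← le_div_iff₀ hip]
      refine ContinuousLinearMap.opNorm_le_bound _ (by positivity) fun e => ?_
      set v := Ring.inverse (1 - z • b) e
      have hv : (1 - z • b) v = e :=
        congrArg (fun S : Y →L[ℂ] Y => S e) (Ring.mul_inverse_cancel _ hu)
      have hTbv : B (b v) = v := congrArg (fun S : Y →L[ℂ] Y => S v) hTb
      have hve : v = e + z • b v := by rw [← hv]; simp
      have h := him z (b v) hz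
      have he : B (b v) - z • b v = e := by
        rw [hTbv, sub_eq_iff_eq_add]
        exact hve
      rw [he] at h
      have hle : |z.im| ≤ ‖z‖ := Complex.abs_im_le_norm z
      have h3 : ‖v‖ ≤ ‖e‖ + ‖z‖ * ‖b v‖ := by
        conv_lhs => rw [hve]
        exact (norm_add_le _ _).trans (by rw [norm_smul])
      rw [div_mul_eq_mul_div, le_div_iff₀ hip]
      calc ‖v‖ * |z.im| ≤ (‖e‖ + ‖z‖ * ‖b v‖) * |z.im| := by gcongr
        _ = |z.im| * ‖e‖ + ‖z‖ * (|z.im| * ‖b v‖) := by ring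
        _ ≤ ‖z‖ * ‖e‖ + ‖z‖ * (C * ‖e‖) := by gcongr
        _ = (C + 1) * ‖z‖ * ‖e‖ := by ring
    · rw [hb]
      exact (hB z hz).mul hbunit
  have hby : b (B y) = y := congrArg (fun S : Y →L[ℂ] Y => S y) hbT
  have h := b.le_of_opNorm_le hnorm (B y)
  rw [hby] at h
  calc r * ‖y‖ ≤ r * (6 * (C + 1) * r⁻¹ * ‖B y‖) := by gcongr
    _ = 6 * (C + 1) * ‖B y‖ := by field_simp

theorem IsHOperator.mul_norm_le_of_mem_eigenspaceSum (hH : IsHOperator T C)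
    (hC : 0 ≤ C) {s : Finset ℂ} [FiniteDimensional ℂ (eigenspaceSum T.toLinearMap s)] {r : ℝ}
    (hr : 0 < r) (hs : ∀ μ ∈ s, r < ‖μ‖) {x : X} (hx : x ∈ eigenspaceSum T.toLinearMap s) :
    r * ‖x‖ ≤ 6 * (C + 1) * ‖T x‖ := by
  refine mul_norm_le_of_finiteDimensional (Y := eigenspaceSum T.toLinearMap s)
    (B := T.restrict fun y hy => map_mem_eigenspaceSum hy) hC hr (fun z hz => ?_)
    (fun z y hz => hH.abs_im_mul_norm_le hz (y : X)) ⟨x, hx⟩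
  rw [ContinuousLinearMap.isUnit_iff_bijective]
  have hsurj : Function.Surjective
      (T.restrict (fun y hy => map_mem_eigenspaceSum hy) - z • (1 : _ →L[ℂ] _) :
        eigenspaceSum T.toLinearMap s →L[ℂ] eigenspaceSum T.toLinearMap s).toLinearMap := by
    rintro ⟨y, hy⟩
    obtain ⟨w, hw, h⟩ := exists_map_sub_smul_eq (fun h => (hs z h).not_ge hz) hy
    exact ⟨⟨w, hw⟩, Subtype.ext h⟩
  exact ⟨LinearMap.injective_iff_surjective.2 hsurj, hsurj⟩

theorem IsHOperator.le_mul_approxNumber (hH : IsHOperator T C)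
    (hC : 0 ≤ C) {s : Finset ℂ} [FiniteDimensional ℂ (eigenspaceSum T.toLinearMap s)] {r : ℝ}
    (hr : 0 < r) (hs : ∀ μ ∈ s, r < ‖μ‖) {n : ℕ}
    (hn : n < Module.finrank ℂ (eigenspaceSum T.toLinearMap s)) :
    r ≤ 6 * (C + 1) * approxNumber T n := by
  have hK : 0 < 6 * (C + 1) := by positivity
  rw [← div_le_iff₀' hK]
  refine le_csInf ⟨_, 0, by simp, rfl⟩ ?_
  rintro _ ⟨A, hA, rfl⟩
  obtain ⟨x, hx, hx0, hAx⟩ : ∃ x ∈ eigenspaceSum T.toLinearMap s, x ≠ 0 ∧ A x = 0 := by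
    by_contra! hcon
    have hinj : Function.Injective
        (A.toLinearMap.rangeRestrict ∘ₗ (eigenspaceSum T.toLinearMap s).subtype) := by
      rw [injective_iff_map_eq_zero]
      intro y hy
      by_contra hy0
      exact hcon y y.2 (fun h => hy0 (Subtype.ext h)) (congrArg Subtype.val hy)
    have h := (LinearMap.rank_le_of_injective _ hinj).trans hA
    rw [← Module.finrank_eq_rank] at h
    exact absurd hn (by exact_mod_cast h.not_gt)
  have h1 := hH.mul_norm_le_of_mem_eigenspaceSum hC hr hs hx
  have h2 : ‖T x‖ ≤ ‖T - A‖ * ‖x‖ := by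
    simpa [hAx] using (T - A).le_opNorm x
  have hxp : 0 < ‖x‖ := norm_pos_iff.2 hx0
  rw [div_le_iff₀' hK]
  refine le_of_mul_le_mul_right ?_ hxp
  calc r * ‖x‖ ≤ 6 * (C + 1) * ‖T x‖ := h1
    _ ≤ 6 * (C + 1) * (‖T - A‖ * ‖x‖) := by gcongr
    _ = 6 * (C + 1) * ‖T - A‖ * ‖x‖ := by ring

end HOperator

section Enumeration

variable {X : Type*} [NormedAddCommGroup X] [NormedSpace ℂ X] {T : X →L[ℂ] X} {lam : ℕ → ℂ}

theorem IsEigenvalueEnumeration.antitone_norm (h : IsEigenvalueEnumeration T lam) :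
    Antitone fun n => ‖lam n‖ :=
  antitone_nat_of_succ_le h.1

/-- If a set of indices contains every index of each of its values, its size is the sum of the
algebraic multiplicities of these values. -/
theorem IsEigenvalueEnumeration.sum_algebraicMultiplicity (h : IsEigenvalueEnumeration T lam)
    {t : Finset ℕ} (ht : ∀ n ∈ t, lam n ≠ 0) (hsat : ∀ n ∈ t, ∀ m, lam m = lam n → m ∈ t) :
    ∑ μ ∈ t.image lam, algebraicMultiplicity T μ = t.card := by
  rw [Finset.card_eq_sum_card_image lam t]
  refine Finset.sum_congr rfl fun μ hμ => ?_
  obtain ⟨n, hn, rfl⟩ := Finset.mem_image.1 hμ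
  rw [← (h.2.2.1 _ (ht n hn)).2, ← Set.ncard_coe_finset]
  congr 1
  ext m
  simpa using fun hm => hsat n hn m hm

theorem IsEigenvalueEnumeration.card_le_sum_algebraicMultiplicity
    (h : IsEigenvalueEnumeration T lam) {t : Finset ℕ} (ht : ∀ n ∈ t, lam n ≠ 0) :
    t.card ≤ ∑ μ ∈ t.image lam, algebraicMultiplicity T μ := by
  rw [Finset.card_eq_sum_card_image lam t]
  refine Finset.sum_le_sum fun μ hμ => ?_
  obtain ⟨n, hn, rfl⟩ := Finset.mem_image.1 hμ
  rw [← (h.2.2.1 _ (ht n hn)).2, ← Set.ncard_coe_finset]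
  exact Set.ncard_le_ncard (fun m hm => by simpa using (Finset.mem_filter.1 hm).2)
    (h.2.2.1 _ (ht n hn)).1

theorem IsEigenvalueEnumeration.exists_mem_Ioo (h : IsEigenvalueEnumeration T lam) {a b : ℝ}
    (ha : 0 ≤ a) (hab : a < b) :
    ∃ r ∈ Set.Ioo a b, ∀ μ ∈ spectrum ℂ T, ‖μ‖ ≠ r ∧ ‖μ‖ ≠ 2 * r := by
  have hc : (Set.range (fun n => ‖lam n‖) ∪ Set.range fun n => ‖lam n‖ / 2).Countable :=
    (Set.countable_range _).union (Set.countable_range _)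
  obtain ⟨r, hr, hr'⟩ := hc.dense_compl ℝ |>.inter_open_nonempty _ isOpen_Ioo
    (Set.nonempty_Ioo.2 hab)
  have hpos : 0 < r := ha.trans_lt hr.1
  refine ⟨r, hr, fun μ hμ => ?_⟩
  rcases eq_or_ne μ 0 with rfl | h0
  · constructor <;> rw [norm_zero] <;> positivity
  · obtain ⟨n, rfl⟩ := h.2.2.2 μ hμ h0
    exact ⟨fun e => hr' (.inl ⟨n, e⟩), fun e => hr' (.inr ⟨n, by simp [e]⟩)⟩

variable [CompleteSpace X] {C : ℝ}

theorem IsHOperator.finrank_eigenspaceSum (hH : IsHOperator T C) (hT : IsCompactOperator T)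
    {s : Finset ℂ} (hs : ∀ μ ∈ s, μ ≠ 0) :
    Module.finrank ℂ (eigenspaceSum T.toLinearMap s) = ∑ μ ∈ s, algebraicMultiplicity T μ := by
  rw [_root_.finrank_eigenspaceSum fun μ hμ => hT.finiteDimensional_eigenspace (hs μ hμ)]
  exact Finset.sum_congr rfl fun μ _ => (hH.algebraicMultiplicity_eq μ).symm

theorem IsHOperator.approxNumber_le (hH : IsHOperator T C) (hC : 0 ≤ C)
    (hT : IsCompactOperator T) (hlam : IsEigenvalueEnumeration T lam) (n : ℕ) :
    approxNumber T n ≤ 6 * C * ‖lam n‖ := by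
  set t := (Finset.range n).filter fun j => ‖lam n‖ < ‖lam j‖ with ht
  have hmem : ∀ j, j ∈ t ↔ ‖lam n‖ < ‖lam j‖ := fun j => by
    refine ⟨fun h => (Finset.mem_filter.1 h).2, fun h => Finset.mem_filter.2 ⟨?_, h⟩⟩
    exact Finset.mem_range.2 (lt_of_not_ge fun hj => h.not_ge (hlam.antitone_norm hj))
  have ht0 : ∀ j ∈ t, lam j ≠ 0 := fun j hj =>
    norm_pos_iff.1 ((norm_nonneg _).trans_lt ((hmem j).1 hj))
  have hs : ∀ μ ∈ t.image lam, μ ≠ 0 := by simpa using ht0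
  have hfin : Module.finrank ℂ (eigenspaceSum T.toLinearMap (t.image lam)) ≤ n := by
    rw [hH.finrank_eigenspaceSum hT hs, hlam.sum_algebraicMultiplicity ht0 fun j hj m hm =>
      (hmem m).2 (hm ▸ (hmem j).1 hj)]
    exact (Finset.card_filter_le _ _).trans (Finset.card_range n).le
  have key : ∀ b, ‖lam n‖ < b → approxNumber T n ≤ 6 * C * b := by
    intro b hb
    obtain ⟨r, hr, hr'⟩ := hlam.exists_mem_Ioo (norm_nonneg _) hb
    have hpos : 0 < r := (norm_nonneg _).trans_lt hr.1
    refine (hH.approxNumber_le_of_spectrum hC hT hs hpos (fun μ hμ hle => ?_)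
      (fun μ hμ => (hr' μ hμ).1) (fun μ hμ => (hr' μ hμ).2) hfin).trans ?_
    · obtain ⟨j, rfl⟩ := hlam.2.2.2 μ hμ (norm_pos_iff.1 (hpos.trans_le hle))
      exact Finset.mem_image_of_mem _ ((hmem j).2 (hr.1.trans_le hle))
    · have := hr.2.le
      gcongr
  refine ge_of_tendsto (x := nhdsWithin ‖lam n‖ (Set.Ioi ‖lam n‖)) (f := fun b => 6 * C * b) ?_ ?_
  · exact ((continuous_const.mul continuous_id).tendsto _).mono_left nhdsWithin_le_nhds
  · filter_upwards [self_mem_nhdsWithin] with b hb using key b hb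

theorem IsHOperator.norm_le_approxNumber (hH : IsHOperator T C) (hC : 0 ≤ C)
    (hT : IsCompactOperator T) (hlam : IsEigenvalueEnumeration T lam) (n : ℕ) :
    ‖lam n‖ ≤ 6 * (C + 1) * approxNumber T n := by
  have hnn := approxNumber_nonneg T n
  refine le_of_forall_lt_imp_le_of_dense fun r hr => ?_
  rcases le_or_gt r 0 with hr0 | hr0
  · exact hr0.trans (by positivity)
  have hlt : ∀ j ∈ Finset.range (n + 1), r < ‖lam j‖ := fun j hj =>
    hr.trans_le (hlam.antitone_norm (Nat.lt_succ_iff.1 (Finset.mem_range.1 hj)))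
  have h0 : ∀ j ∈ Finset.range (n + 1), lam j ≠ 0 := fun j hj =>
    norm_pos_iff.1 (hr0.trans (hlt j hj))
  have hs : ∀ μ ∈ (Finset.range (n + 1)).image lam, μ ≠ 0 := by
    rintro _ hμ
    obtain ⟨j, hj, rfl⟩ := Finset.mem_image.1 hμ
    exact h0 j hj
  have := finiteDimensional_eigenspaceSum (f := T.toLinearMap)
    fun μ hμ => hT.finiteDimensional_eigenspace (hs μ hμ)
  refine hH.le_mul_approxNumber hC hr0 (s := (Finset.range (n + 1)).image lam) (fun μ hμ => ?_) ?_
  · obtain ⟨j, hj, rfl⟩ := Finset.mem_image.1 hμ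
    exact hlt j hj
  · rw [hH.finrank_eigenspaceSum hT hs]
    have := hlam.card_le_sum_algebraicMultiplicity h0
    rwa [Finset.card_range] at this

end Enumeration

theorem MemEllMu.mono {μ : ℝ≥0∞} {c d : ℕ → ℝ} {K : ℝ} (hK : 0 ≤ K)
    (hcd : ∀ n, |c n| ≤ K * |d n|) (hd : MemEllMu μ d) : MemEllMu μ c := by
  unfold MemEllMu at hd ⊢
  split_ifs at hd ⊢ with h
  · obtain ⟨M, hM⟩ := hd
    exact ⟨K * M, fun n => (hcd n).trans (by gcongr; exact hM n)⟩
  · refine Summable.of_nonneg_of_le (fun n => by positivity) (fun n => ?_)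
      (hd.mul_left (K ^ μ.toReal))
    rw [← Real.mul_rpow hK (abs_nonneg _)]
    exact Real.rpow_le_rpow (abs_nonneg _) (hcd n) ENNReal.toReal_nonneg

theorem MemEllMu.mul_mono {μ : ℝ≥0∞} {w a b : ℕ → ℝ} {K : ℝ} (hK : 0 ≤ K) (ha : ∀ n, 0 ≤ a n)
    (hab : ∀ n, a n ≤ K * b n) (hb : MemEllMu μ fun n => w n * b n) :
    MemEllMu μ fun n => w n * a n := by
  refine hb.mono hK fun n => ?_
  rw [abs_mul, abs_mul, abs_of_nonneg (ha n), mul_left_comm]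
  gcongr
  exact (hab n).trans (by gcongr; exact le_abs_self _)

/-- For `0 < ρ < ∞`, `0 < μ ≤ ∞` and a compact H-operator `T` with constant `C` on an
infinite-dimensional complex Banach space with eigenvalue enumeration `(λ_n(T))`,
one has `(n^{ρ - 1/μ} |λ_n(T)|) ∈ ℓ_μ` if and only if `(n^{ρ - 1/μ} α_n(T)) ∈ ℓ_μ`:
the eigenvalue approximation space `A^ρ_μ` coincides with the approximation-number
space `X^ρ_μ`.  (Here `lam n = λ_{n+1}(T)`, `approxNumber T n = α_{n+1}(T)`, and the
exponent `ρ - 1/μ` is `ρ` when `μ = ∞`.) -/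
theorem eigenvalue_space_eq_approx_space {X : Type*} [NormedAddCommGroup X]
    [NormedSpace ℂ X] [CompleteSpace X] (hX : ¬ FiniteDimensional ℂ X)
    (T : X →L[ℂ] X) (C : ℝ) (hC : 1 ≤ C) (hH : IsHOperator T C)
    (hT : IsCompactOperator T) (lam : ℕ → ℂ) (hlam : IsEigenvalueEnumeration T lam)
    (ρ : ℝ) (hρ : 0 < ρ) (μ : ℝ≥0∞) (hμ : 0 < μ) :
    (MemEllMu μ fun n =>
      ((n : ℝ) + 1) ^ (ρ - (μ⁻¹).toReal) * ‖lam n‖) ↔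
    (MemEllMu μ fun n =>
      ((n : ℝ) + 1) ^ (ρ - (μ⁻¹).toReal) * approxNumber T n) := by
  have hC0 : 0 ≤ C := zero_le_one.trans hC
  exact ⟨MemEllMu.mul_mono (by positivity) (approxNumber_nonneg T) (hH.approxNumber_le hC0 hT hlam),
    MemEllMu.mul_mono (by positivity) (fun n => norm_nonneg _)
      (hH.norm_le_approxNumber hC0 hT hlam)⟩
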